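/- Let $n \ge 1$, $1 < p < 1 + \frac{4}{n}$ with $p > 1 + \frac{2}{n}$, and $k \ge 0$. Suppose $F$ satisfies $\|F(\tau)\|_{L^1(\mathbb{R}^n)} \le C(1+\tau)^{-\frac{n}{2}(p-1)}$. Then there exists $C' > 0$ such that for all $t \ge 2$, $\left\| |\nabla|^k \int_0^{t/2} (e^{(t-\tau)\Delta} - e^{t\Delta}) F(\tau)\, d\tau \right\|_{L^2(\mathbb{R}^n)} \le C' t^{-\frac{n}{4} - \frac{k}{2} - \frac{n}{2}(p-1) + 1}$. In particular, this quantity is $o(t^{-\frac{n}{4} - \frac{k}{2}})$ as $t \to \infty$. -/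

import Mathlib

open MeasureTheory FourierTransform Real Filter
open scoped ENNReal NNReal Topology

/-- The Gauss kernel `G_t(x) = (4πt)^{-n/2} e^{-|x|²/(4t)}`. -/
noncomputable def gaussKernel (n : ℕ) (t : ℝ) (x : EuclideanSpace ℝ (Fin n)) : ℝ :=
  (4 * π * t) ^ (-(n : ℝ) / 2) * Real.exp (-‖x‖ ^ 2 / (4 * t))

/-- The heat semigroup `e^{tΔ} g = G_t * g`. -/
noncomputable def heat {n : ℕ} (t : ℝ) (g : EuclideanSpace ℝ (Fin n) → ℂ)
    (x : EuclideanSpace ℝ (Fin n)) : ℂ :=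
  ∫ y, (gaussKernel n t (x - y) : ℂ) * g y

/-- The fractional derivative `|∇|^s u` with Fourier symbol `|ξ|^s`. -/
noncomputable def fracDeriv {n : ℕ} (s : ℝ) (u : EuclideanSpace ℝ (Fin n) → ℂ) :
    EuclideanSpace ℝ (Fin n) → ℂ :=
  𝓕⁻ (fun ξ => ((‖ξ‖ ^ s : ℝ) : ℂ) * 𝓕 u ξ)


section aux
open Set

abbrev EE (n : ℕ) := EuclideanSpace ℝ (Fin n)

lemma aux_plancherel {n : ℕ} (f : (EE n) → ℂ) (h1 : Integrable f) (h2 : MemLp f 2 volume) :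
    eLpNorm (𝓕 f) 2 volume = eLpNorm f 2 volume := by
  have hcont : Continuous (𝓕 f) := by
    exact VectorFourier.fourierIntegral_continuous Real.continuous_fourierChar
      (by exact continuous_inner) h1
  let G : Lp (α := EE n) ℂ 2 (volume : Measure (EE n)) := 𝓕 (h2.toLp f)
  have key : 𝓕 f =ᵐ[volume] G := by
    apply ae_eq_of_integral_contDiff_smul_eq
    · exact hcont.locallyIntegrable
    · exact (Lp.memLp G).locallyIntegrable (by norm_num)
    · intro g hg hgs
      let φ : SchwartzMap (EE n) ℂ :=
        HasCompactSupport.toSchwartzMap (f := fun x => (g x : ℂ))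
          (hgs.comp_left (g := fun r : ℝ => (r : ℂ)) (by simp)) (Complex.ofRealCLM.contDiff.comp hg)
      have e1 := Lp.fourier_toTemperedDistribution_eq (h2.toLp f)
      have e2 := congrArg (fun T => T φ) e1
      simp only [TemperedDistribution.fourier_apply, Lp.toTemperedDistribution_apply] at e2
      have e3 := VectorFourier.integral_fourierIntegral_smul_eq_flip (μ := (volume : Measure (EE n)))
        (ν := (volume : Measure (EE n))) (L := innerₗ (EE n))
        (f := φ) (g := f) Real.continuous_fourierChar (by exact continuous_inner) φ.integrable h1
      have e4 : ∫ x, (𝓕 φ) x • (h2.toLp f) x = ∫ x, (𝓕 φ) x • f x := by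
        apply integral_congr_ae
        filter_upwards [h2.coeFn_toLp] with x hx
        rw [hx]
      rw [e4] at e2
      have e5 : ∫ x, (𝓕 φ) x • f x = ∫ x, φ x • 𝓕 f x := by
        rw [flip_innerₗ] at e3
        exact e3
      rw [e5] at e2
      have hφ : ∀ x, φ x = (g x : ℂ) := fun x => rfl
      simpa [hφ] using e2
  rw [eLpNorm_congr_ae key, ← Lp.enorm_def, ← eLpNorm_congr_ae h2.coeFn_toLp, ← Lp.enorm_def]
  rw [← ofReal_norm, ← ofReal_norm, Lp.norm_fourier_eq]

lemma aux_plancherel_inv {n : ℕ} (f : (EE n) → ℂ) (h1 : Integrable f) (h2 : MemLp f 2 volume) :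
    eLpNorm (𝓕⁻ f) 2 volume = eLpNorm f 2 volume := by
  rw [← aux_plancherel f h1 h2]
  have : 𝓕⁻ f = (𝓕 f) ∘ (fun x => -x) := by
    ext x; simp [Real.fourierInv_eq_fourier_neg]
  rw [this]
  refine eLpNorm_comp_measurePreserving ?_ (Measure.measurePreserving_neg _)
  exact (VectorFourier.fourierIntegral_continuous Real.continuous_fourierChar
      (by exact continuous_inner) h1).aestronglyMeasurable

section aux2
open Set

lemma aux_meas_entire {T : Type*} [MeasurableSpace T] (μ : Measure T) (Φ : ℂ → T → ℂ)
    (hΦ : ∀ τ, Differentiable ℂ (fun z => Φ z τ)) (z0 : ℂ) (z : ℕ → ℂ)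
    (hz : Tendsto z atTop (𝓝 z0)) (hne : ∀ m, z m ≠ z0)
    (hm : ∀ m, AEStronglyMeasurable (Φ (z m)) μ) (w : ℂ) :
    AEStronglyMeasurable (Φ w) μ := by
  let D : ℕ → ℂ → T → ℂ := fun j ζ τ => ((Function.swap dslope z0)^[j] (fun z => Φ z τ)) ζ
  have hDd : ∀ j τ, Differentiable ℂ (fun ζ => D j ζ τ) := by
    intro j τ
    induction j with
    | zero => exact hΦ τ
    | succ j ih =>
      have : (fun ζ => D (j+1) ζ τ) = dslope (fun ζ => D j ζ τ) z0 := by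
        simp only [D, Function.iterate_succ_apply', Function.swap]
      rw [this, ← differentiableOn_univ, Complex.differentiableOn_dslope univ_mem]
      exact ih.differentiableOn
  have hlim : ∀ j, (∀ m, AEStronglyMeasurable (D j (z m)) μ) →
      AEStronglyMeasurable (D j z0) μ := by
    intro j h
    refine aestronglyMeasurable_of_tendsto_ae atTop h (ae_of_all _ fun τ => ?_)
    exact ((hDd j τ).continuous.tendsto z0).comp hz
  have hDm : ∀ j m, AEStronglyMeasurable (D j (z m)) μ := by
    intro j
    induction j with
    | zero => exact hm
    | succ j ih =>
      intro m
      have : D (j+1) (z m) = fun τ => (z m - z0)⁻¹ * (D j (z m) τ - D j z0 τ) := by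
        ext τ
        simp only [D, Function.iterate_succ_apply']
        change dslope (fun ζ => D j ζ τ) z0 (z m) = _
        rw [dslope_of_ne _ (hne m), slope_def_module]
        rfl
      rw [this]
      exact ((ih m).sub (hlim j ih)).const_mul _
  have hD0 : ∀ j, AEStronglyMeasurable (D j z0) μ := fun j => hlim j (hDm j)
  have hsum : ∀ τ, HasSum (fun j => (w - z0) ^ j * D j z0 τ) (Φ w τ) := by
    intro τ
    have hp := (hΦ τ).hasFPowerSeriesOnBall z0 (R := 1) one_pos
    have h1 := hp.hasSum_sub (y := w) (by simp)
    have h3 : (fun j => (w - z0) ^ j * D j z0 τ) = fun j => (cauchyPowerSeries (fun z => Φ z τ) z0 ((1 : ℝ≥0) : ℝ) j) fun _ => w - z0 := ?_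
    · rw [h3]; exact h1
    ext j
    have h2 := (hp.hasFPowerSeriesAt.has_fpower_series_iterate_dslope_fslope j).coeff_zero 1
    rw [← FormalMultilinearSeries.coeff, FormalMultilinearSeries.coeff_iterate_fslope, zero_add] at h2
    rw [FormalMultilinearSeries.apply_eq_pow_smul_coeff, h2]
    rfl
  refine aestronglyMeasurable_of_tendsto_ae atTop
    (f := fun N τ => ∑ j ∈ Finset.range N, (w - z0) ^ j * D j z0 τ) (fun N => ?_)
    (ae_of_all _ fun τ => (hsum τ).tendsto_sum_nat)
  exact Finset.aestronglyMeasurable_fun_sum _ fun j _ => (hD0 j).const_mul _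

lemma aux_meas_line {T : Type*} [MeasurableSpace T] (μ : Measure T) (Φ : ℂ → T → ℂ)
    (hΦ : ∀ τ, Differentiable ℂ (fun z => Φ z τ))
    (hpos : volume {s : ℝ | AEStronglyMeasurable (Φ s) μ} ≠ 0) (w : ℂ) :
    AEStronglyMeasurable (Φ w) μ := by
  set S := {s : ℝ | AEStronglyMeasurable (Φ s) μ}
  obtain ⟨x, hx, hu⟩ := exists_mem_forall_mem_nhdsWithin_pos_measure hpos
  have hfreq : ∀ k : ℕ, ∃ y ∈ S, y ≠ x ∧ dist y x < 1 / ((k:ℝ) + 1) := by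
    intro k
    by_contra! hcon
    have h1 : S ∩ Metric.ball x (1 / ((k:ℝ)+1)) ∈ 𝓝[S] x :=
      inter_mem_nhdsWithin _ (Metric.ball_mem_nhds _ (by positivity))
    have h2 := hu _ h1
    have h3 : S ∩ Metric.ball x (1 / ((k:ℝ)+1)) ⊆ {x} := by
      rintro y ⟨hy, hyb⟩
      by_contra hyx
      exact absurd (Metric.mem_ball.1 hyb) (not_lt.2 (hcon y hy hyx))
    exact absurd (measure_mono_null h3 (by simp)) h2.ne'
  choose y hyS hyx hyd using hfreq
  refine aux_meas_entire μ Φ hΦ (x:ℂ) (fun m => (y m : ℂ)) ?_ ?_ hyS w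
  · refine (Complex.continuous_ofReal.tendsto x).comp ?_
    rw [tendsto_iff_dist_tendsto_zero]
    exact squeeze_zero (fun _ => dist_nonneg) (fun m => (hyd m).le)
      tendsto_one_div_add_atTop_nhds_zero_nat
  · intro m
    exact_mod_cast hyx m

lemma aux_slices (n : ℕ) (M : Set (Fin n → ℝ)) (hM : MeasurableSet M)
    (hline : ∀ (x : Fin n → ℝ) (i : Fin n), volume {s : ℝ | Function.update x i s ∈ M} ≠ 0 →
      ∀ s, Function.update x i s ∈ M) (hpos : volume M ≠ 0) : ∀ x, x ∈ M := by
  induction n with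
  | zero =>
    intro x
    obtain ⟨y, hy⟩ := nonempty_of_measure_ne_zero hpos
    rwa [Subsingleton.elim x y]
  | succ n ih =>
    let e := MeasurableEquiv.piFinSuccAbove (fun _ : Fin (n+1) => ℝ) 0
    have hmp : MeasurePreserving e.symm :=
      (volume_preserving_piFinSuccAbove (fun _ : Fin (n+1) => ℝ) 0).symm
    let N := e.symm ⁻¹' M
    have hN : MeasurableSet N := e.symm.measurable hM
    have hNpos : volume N ≠ 0 := by
      rwa [hmp.measure_preimage hM.nullMeasurableSet]
    have he : ∀ s y, e.symm (s, y) = Fin.cons s y := by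
      intro s y
      simp [e, MeasurableEquiv.piFinSuccAbove]
      rfl
    rw [Measure.volume_eq_prod, Ne, Measure.measure_prod_null hN] at hNpos
    have hA : volume {s : ℝ | volume (Prod.mk s ⁻¹' N) ≠ 0} ≠ 0 := by
      intro h; exact hNpos (by rw [Filter.EventuallyEq, ae_iff]; exact h)
    have hfull : ∀ s : ℝ, volume (Prod.mk s ⁻¹' N) ≠ 0 → ∀ y, Fin.cons s y ∈ M := by
      intro s hs y
      have := ih (Prod.mk s ⁻¹' N) (measurable_prodMk_left hN) ?_ hs y
      · rw [← he]; exact this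
      · intro x i hx r
        have := hline (Fin.cons s x) i.succ
        simp only [Fin.cons_update, mem_preimage, N, he] at this hx ⊢
        exact this hx r
    intro x
    have := hline x 0 ?_ (x 0)
    · simpa using this
    · refine fun h => hA (measure_mono_null (fun s hs => ?_) h)
      have := hfull s hs (Fin.tail x)
      simp only [mem_ofPred_eq]
      convert this using 1
      conv_lhs => rw [← Fin.cons_self_tail x, Fin.update_cons_zero]

section aux3
open Set

lemma aux_gk_cont (n : ℕ) (s : ℝ) : Continuous (gaussKernel n s) := by
  unfold gaussKernel; fun_prop

lemma aux_gk_nonneg (n : ℕ) {s : ℝ} (hs : 0 < s) (x : EE n) : 0 ≤ gaussKernel n s x := by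
  unfold gaussKernel; positivity

lemma aux_gk_pos (n : ℕ) {s : ℝ} (hs : 0 < s) (x : EE n) : 0 < gaussKernel n s x := by
  unfold gaussKernel; positivity

lemma aux_gk_le (n : ℕ) {s : ℝ} (hs : 0 < s) (x : EE n) :
    gaussKernel n s x ≤ (4 * π * s) ^ (-(n : ℝ) / 2) := by
  unfold gaussKernel
  refine mul_le_of_le_one_right (by positivity) ?_
  rw [Real.exp_le_one_iff]
  rw [neg_div]
  have : 0 ≤ ‖x‖ ^ 2 / (4 * s) := by positivity
  linarith

lemma aux_gk_integrable (n : ℕ) {s : ℝ} (hs : 0 < s) :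
    Integrable (fun x : EE n => (gaussKernel n s x : ℂ)) := by
  have h := GaussianFourier.integrable_cexp_neg_mul_sq_norm_add (V := EE n)
    (b := ((1 / (4 * s) : ℝ) : ℂ)) (by rw [Complex.ofReal_re]; positivity) 0 0
  refine (h.const_mul (((4 * π * s) ^ (-(n : ℝ) / 2) : ℝ) : ℂ)).congr (ae_of_all _ fun x => ?_)
  simp only [gaussKernel]
  push_cast
  congr 2
  simp
  field_simp

lemma aux_gk_fourier (n : ℕ) {s : ℝ} (hs : 0 < s) (ξ : EE n) :
    𝓕 (fun x : EE n => (gaussKernel n s x : ℂ)) ξ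
      = (Real.exp (-(4 * π ^ 2 * s * ‖ξ‖ ^ 2)) : ℂ) := by
  have h := fourier_gaussian_innerProductSpace (V := EE n)
    (b := ((1 / (4 * s) : ℝ) : ℂ)) (by rw [Complex.ofReal_re]; positivity) ξ
  have e : (fun x : EE n => (gaussKernel n s x : ℂ)) =
      (((4 * π * s) ^ (-(n : ℝ) / 2) : ℝ) : ℂ) •
        (fun x : EE n => Complex.exp (-((1 / (4 * s) : ℝ) : ℂ) * (‖x‖:ℂ) ^ 2)) := by
    ext x
    simp only [gaussKernel, Pi.smul_apply, smul_eq_mul]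
    push_cast
    congr 2
    field_simp
  have hsm := congrFun (VectorFourier.fourierIntegral_const_smul Real.fourierChar
    (volume : Measure (EE n)) (innerₗ (EE n))
    (fun x : EE n => Complex.exp (-((1 / (4 * s) : ℝ) : ℂ) * (‖x‖:ℂ) ^ 2))
    (((4 * π * s) ^ (-(n : ℝ) / 2) : ℝ) : ℂ)) ξ
  rw [e]
  refine hsm.trans ?_
  rw [Pi.smul_apply, smul_eq_mul]
  refine (congrArg _ h).trans ?_
  have e2 : (π / ((1 / (4 * s) : ℝ) : ℂ)) = ((4 * π * s : ℝ) : ℂ) := by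
    push_cast; field_simp
  rw [e2, finrank_euclideanSpace, Fintype.card_fin]
  have e3 : ((4 * π * s : ℝ) : ℂ) ^ ((n : ℂ) / 2) = (((4 * π * s) ^ ((n : ℝ) / 2) : ℝ) : ℂ) := by
    rw [Complex.ofReal_cpow (by positivity)]; push_cast; rfl
  rw [e3, ← mul_assoc, ← Complex.ofReal_mul, ← Real.rpow_add (by positivity)]
  rw [neg_div, neg_add_cancel, Real.rpow_zero, Complex.ofReal_one, one_mul]
  push_cast
  congr 1
  field_simp

lemma aux_gk_integral (n : ℕ) {s : ℝ} (hs : 0 < s) : ∫ x : EE n, gaussKernel n s x = 1 := by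
  have h := aux_gk_fourier n hs 0
  rw [Real.fourier_eq] at h
  simp only [inner_zero_right, neg_zero, AddChar.map_zero_eq_one, one_smul] at h
  rw [integral_complex_ofReal] at h
  simpa using h

lemma aux_heat_conv {n : ℕ} (s : ℝ) (g : EE n → ℂ) :
    heat s g = convolution g (fun x : EE n => (gaussKernel n s x : ℂ))
      (ContinuousLinearMap.mul ℂ ℂ) volume := by
  ext x
  simp only [heat, convolution, ContinuousLinearMap.mul_apply']
  congr 1; ext y; ring

lemma aux_heat_fourier {n : ℕ} {s : ℝ} (hs : 0 < s) (g : EE n → ℂ) (hg : Integrable g) (ξ : EE n) :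
    𝓕 (heat s g) ξ = (Real.exp (-(4 * π ^ 2 * s * ‖ξ‖ ^ 2)) : ℂ) * 𝓕 g ξ := by
  rw [aux_heat_conv, Real.fourier_mul_convolution_eq hg (aux_gk_integrable n hs),
    aux_gk_fourier n hs, mul_comm]

lemma aux_heat_integrable {n : ℕ} {s : ℝ} (hs : 0 < s) (g : EE n → ℂ) (hg : Integrable g) :
    Integrable (heat s g) := by
  rw [aux_heat_conv]
  exact hg.integrable_convolution _ (aux_gk_integrable n hs)

lemma aux_heat_norm {n : ℕ} {s : ℝ} (hs : 0 < s) (g : EE n → ℂ) (hg : Integrable g) :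
    ∫ x, ‖heat s g x‖ ≤ ∫ x, ‖g x‖ := by
  have hG : Integrable (fun x : EE n => gaussKernel n s x) := by
    have := (aux_gk_integrable n hs).re
    simpa using this
  have h1 := integral_convolution (μ := (volume : Measure (EE n))) (ν := volume)
    (ContinuousLinearMap.mul ℝ ℝ) hg.norm hG
  rw [aux_gk_integral n hs] at h1
  simp only [ContinuousLinearMap.mul_apply', mul_one] at h1
  rw [← h1]
  refine integral_mono (aux_heat_integrable hs g hg).norm
    (hg.norm.integrable_convolution _ hG) fun x => ?_
  simp only [heat, convolution, ContinuousLinearMap.mul_apply']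
  refine (norm_integral_le_integral_norm _).trans (le_of_eq ?_)
  congr 1; ext y
  rw [norm_mul, Complex.norm_real, Real.norm_of_nonneg (aux_gk_nonneg n hs _), mul_comm]

lemma aux_heat_continuous {n : ℕ} {s : ℝ} (hs : 0 < s) (g : EE n → ℂ) (hg : Integrable g) :
    Continuous (heat s g) := by
  unfold heat
  refine continuous_of_dominated (bound := fun y => (4 * π * s) ^ (-(n : ℝ) / 2) * ‖g y‖)
    (fun x => ?_) (fun x => ae_of_all _ fun y => ?_) (hg.norm.const_mul _)
    (ae_of_all _ fun y => ?_)
  · refine AEStronglyMeasurable.mul ?_ hg.1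
    exact (Complex.continuous_ofReal.comp
      ((aux_gk_cont n s).comp (by fun_prop))).aestronglyMeasurable
  · rw [norm_mul, Complex.norm_real, Real.norm_of_nonneg (aux_gk_nonneg n hs _)]
    gcongr
    exact aux_gk_le n hs _
  · exact (Complex.continuous_ofReal.comp
      ((aux_gk_cont n s).comp (by fun_prop))).mul continuous_const

lemma aux_heat_not_meas {n : ℕ} {s : ℝ} (hs : 0 < s) (g : EE n → ℂ)
    (hg : ¬ AEStronglyMeasurable g volume) (x : EE n) : heat s g x = 0 := by
  unfold heat
  apply integral_non_aestronglyMeasurable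
  intro h
  apply hg
  have hk : AEStronglyMeasurable (fun y : EE n => ((gaussKernel n s (x - y))⁻¹ : ℂ)) volume := by
    refine Continuous.aestronglyMeasurable ?_
    refine Continuous.inv₀ (Complex.continuous_ofReal.comp
      ((aux_gk_cont n s).comp (by fun_prop))) fun y => ?_
    exact_mod_cast (aux_gk_pos n hs _).ne'
  refine (hk.mul h).congr (ae_of_all _ fun y => ?_)
  have : (gaussKernel n s (x - y) : ℂ) ≠ 0 := by exact_mod_cast (aux_gk_pos n hs _).ne'
  simp only [Pi.mul_apply]
  field_simp

/-- complexified heat extension in one coordinate direction -/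
noncomputable def auxH {n : ℕ} (s : ℝ) (g : EE n → ℂ) (x : EE n) (i : Fin n) (z : ℂ) : ℂ :=
  ∫ y, ((((4 * π * s) ^ (-(n : ℝ) / 2) : ℝ) : ℂ) *
    Complex.exp (-((‖x - y‖ : ℂ) ^ 2 + 2 * z * ((x - y) i : ℝ) + z ^ 2) / (4 * s))) * g y

lemma aux_H_real {n : ℕ} (s : ℝ) (g : EE n → ℂ) (x : EE n) (i : Fin n) (r : ℝ) :
    auxH s g x i r = heat s g (x + EuclideanSpace.single i r) := by
  unfold auxH heat gaussKernel
  congr 1; ext y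
  have : ‖x + EuclideanSpace.single i r - y‖ ^ 2 = ‖x - y‖ ^ 2 + 2 * r * (x - y) i + r ^ 2 := by
    rw [show x + EuclideanSpace.single i r - y = (x - y) + EuclideanSpace.single i r by abel,
      norm_add_sq_real, EuclideanSpace.inner_single_right]
    simp
    ring
  rw [this]
  push_cast
  rfl

lemma aux_H_bound {s R ρ a : ℝ} (hs : 0 < s) (hR : 0 ≤ R) (_hρ : 0 ≤ ρ) (ha : |a| ≤ ρ) (z : ℂ)
    (hz : ‖z‖ ≤ R) :
    ‖Complex.exp (-((ρ : ℂ) ^ 2 + 2 * z * a + z ^ 2) / (4 * s))‖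
      ≤ Real.exp (3 * R ^ 2 / (4 * s)) * Real.exp (-(ρ ^ 2 / (8 * s))) := by
  rw [Complex.norm_exp, ← Real.exp_add, Real.exp_le_exp]
  have e : (-((ρ : ℂ) ^ 2 + 2 * z * a + z ^ 2) / (4 * s)).re
      = -(ρ ^ 2 + 2 * z.re * a + (z.re ^ 2 - z.im ^ 2)) / (4 * s) := by
    rw [show (4 * (s:ℂ)) = ((4 * s : ℝ) : ℂ) by push_cast; rfl, Complex.div_ofReal_re]
    congr 1
    simp [pow_two]
  rw [e]
  have h1 : |z.re| ≤ R := (Complex.abs_re_le_norm z).trans hz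
  have h2 : |z.im| ≤ R := (Complex.abs_im_le_norm z).trans hz
  have h3 : |z.re * a| ≤ R * ρ := by rw [abs_mul]; gcongr
  have h4 : z.im ^ 2 ≤ R ^ 2 := sq_le_sq' (by linarith [(abs_le.1 h2).1]) (abs_le.1 h2).2
  have h5 := (abs_le.1 h3).1
  have e2 : 3 * R ^ 2 / (4 * s) + -(ρ ^ 2 / (8 * s)) = (3 * R ^ 2 - ρ ^ 2 / 2) / (4 * s) := by
    field_simp; ring
  rw [e2]
  apply div_le_div_of_nonneg_right _ (by positivity)
  nlinarith [sq_nonneg (ρ - 2 * R), sq_nonneg z.re]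

lemma aux_H_diff {n : ℕ} {s : ℝ} (hs : 0 < s) (g : EE n → ℂ) (hg : Integrable g) (x : EE n)
    (i : Fin n) : Differentiable ℂ (auxH s g x i) := by
  intro z0
  set c : ℂ := (((4 * π * s) ^ (-(n : ℝ) / 2) : ℝ) : ℂ)
  let Q : ℂ → EE n → ℂ := fun z y =>
    Complex.exp (-((‖x - y‖ : ℂ) ^ 2 + 2 * z * ((x - y) i : ℝ) + z ^ 2) / (4 * s))
  let L : ℂ → EE n → ℂ := fun z y => -(2 * ((x - y) i : ℝ) + 2 * z) / (4 * s)
  have hQc : ∀ z, Continuous (Q z) := by intro z; simp only [Q]; fun_prop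
  have hLc : ∀ z, Continuous (L z) := by intro z; simp only [L]; fun_prop
  set R := ‖z0‖ + 1
  have hR : 0 ≤ R := by positivity
  have hco : ∀ y : EE n, |(x - y) i| ≤ ‖x - y‖ := fun y => by
    simpa using EuclideanSpace.norm_eq (x - y) ▸ (PiLp.norm_apply_le (x - y) i)
  have hQb : ∀ z : ℂ, ‖z‖ ≤ R → ∀ y, ‖Q z y‖ ≤
      Real.exp (3 * R ^ 2 / (4 * s)) * Real.exp (-(‖x - y‖ ^ 2 / (8 * s))) := fun z hz y =>
    aux_H_bound hs hR (norm_nonneg _) (hco y) z hz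
  have hLb : ∀ z : ℂ, ‖z‖ ≤ R → ∀ y, ‖L z y‖ ≤ (‖x - y‖ + R) / (2 * s) := by
    intro z hz y
    simp only [L]
    rw [norm_div, norm_neg]
    have : ‖(4 * s : ℂ)‖ = 4 * s := by
      rw [norm_mul, Complex.norm_real, Real.norm_of_nonneg hs.le]; norm_num
    rw [this, div_le_div_iff₀ (by positivity) (by positivity)]
    have h1 : ‖2 * (((x - y) i : ℝ) : ℂ) + 2 * z‖ ≤ 2 * ‖x - y‖ + 2 * R := by
      refine (norm_add_le _ _).trans ?_
      rw [norm_mul, norm_mul, Complex.norm_real, Complex.norm_ofNat, Real.norm_eq_abs]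
      gcongr
      exact hco y
    nlinarith
  let B : ℝ := ‖c‖ * (Real.exp (3 * R ^ 2 / (4 * s)) * ((1 + 8 * s + R) / (2 * s)))
  have main := hasDerivAt_integral_of_dominated_loc_of_deriv_le (μ := (volume : Measure (EE n)))
    (F := fun z y => c * Q z y * g y) (F' := fun z y => c * (Q z y * L z y) * g y) (x₀ := z0)
    (s := Metric.ball z0 1) (bound := fun y => B * ‖g y‖) (Metric.ball_mem_nhds _ one_pos)
    (Eventually.of_forall fun z => ?_) ?_ ?_ (ae_of_all _ fun y z hz => ?_) (hg.norm.const_mul _)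
    (ae_of_all _ fun y z hz => ?_)
  · exact main.2.differentiableAt
  · exact (continuous_const.mul (hQc z)).aestronglyMeasurable.mul hg.1
  · refine hg.bdd_mul (c := ‖c‖ * Real.exp (3 * R ^ 2 / (4 * s)))
      (continuous_const.mul (hQc z0)).aestronglyMeasurable (ae_of_all _ fun y => ?_)
    rw [norm_mul]
    gcongr
    refine (hQb z0 (by simp [R]) y).trans (mul_le_of_le_one_right (by positivity) ?_)
    rw [Real.exp_le_one_iff]
    have : 0 ≤ ‖x - y‖ ^ 2 / (8 * s) := by positivity
    linarith
  · exact (continuous_const.mul ((hQc z0).mul (hLc z0))).aestronglyMeasurable.mul hg.1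
  · have hz' : ‖z‖ ≤ R := by
      have := norm_sub_norm_le z z0
      rw [Metric.mem_ball, dist_eq_norm] at hz
      simp only [R]; linarith
    rw [norm_mul, norm_mul, norm_mul]
    simp only [B]
    refine mul_le_mul_of_nonneg_right (mul_le_mul_of_nonneg_left ?_ (norm_nonneg _)) (norm_nonneg _)
    refine (mul_le_mul (hQb z hz' y) (hLb z hz' y) (norm_nonneg _) (by positivity)).trans ?_
    rw [mul_assoc, ← mul_div_assoc]
    gcongr
    set ρ := ‖x - y‖
    have hρ : 0 ≤ ρ := norm_nonneg _
    set u := ρ ^ 2 / (8 * s) with hu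
    have hu0 : 0 ≤ u := by positivity
    have hρu : ρ ^ 2 = 8 * s * u := by rw [hu]; field_simp
    have hexp : u + 1 ≤ Real.exp u := Real.add_one_le_exp u
    rw [Real.exp_neg, inv_mul_le_iff₀ (Real.exp_pos _)]
    have : ρ ≤ 1 + ρ ^ 2 := by nlinarith [sq_nonneg (ρ - 1)]
    have h8 : 0 ≤ 1 + 8 * s + R := by positivity
    nlinarith [mul_le_mul_of_nonneg_right hexp h8, mul_nonneg hu0 hR]
  · have h1 : HasDerivAt (fun z : ℂ => -((‖x - y‖ : ℂ) ^ 2 + 2 * z * ((x - y) i : ℝ) + z ^ 2) / (4 * s))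
        (L z y) z := by
      have h2 : HasDerivAt (fun z : ℂ => 2 * z * (((x - y) i : ℝ) : ℂ))
          (2 * (((x - y) i : ℝ) : ℂ)) z := by
        simpa using ((hasDerivAt_id z).const_mul 2).mul_const (((x - y) i : ℝ) : ℂ)
      have h3 : HasDerivAt (fun z : ℂ => z ^ 2) (2 * z) z := by simpa using hasDerivAt_pow 2 z
      exact (((h2.const_add _).add h3).neg.div_const _)
    exact (((h1.cexp).const_mul c).mul_const (g y))

section aux4
open Set

lemma aux_carath {X T : Type*} [MetricSpace X] [MeasurableSpace X] [BorelSpace X]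
    [SecondCountableTopology X] [Nonempty X] [MeasurableSpace T] (κ : Measure X) [SFinite κ]
    (ν : Measure T) [SFinite ν] (f : X → T → ℂ) (hc : ∀ τ, Continuous fun x => f x τ)
    (hm : ∀ x, AEStronglyMeasurable (f x) ν) :
    AEStronglyMeasurable (fun q : X × T => f q.1 q.2) (κ.prod ν) := by
  classical
  let d := TopologicalSpace.denseSeq X
  have hd : DenseRange d := TopologicalSpace.denseRange_denseSeq X
  have hae : ∀ᵐ τ ∂ν, ∀ k, f (d k) τ = (hm (d k)).mk (f (d k)) τ :=
    ae_all_iff.2 fun k => (hm (d k)).ae_eq_mk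
  obtain ⟨A, hAsub, hAm, hA0⟩ := exists_measurable_superset_of_null (ae_iff.1 hae)
  have hAe : ∀ τ, τ ∉ A → ∀ k, f (d k) τ = (hm (d k)).mk (f (d k)) τ := by
    intro τ hτ
    by_contra hcon
    exact hτ (hAsub hcon)
  let f' : X → T → ℂ := fun x τ => Aᶜ.indicator (f x) τ
  have hf'c : ∀ τ, Continuous fun x => f' x τ := by
    intro τ
    by_cases hτ : τ ∈ A
    · simpa [f', hτ] using continuous_const
    · simpa [f', hτ] using hc τ
  have hf'd : ∀ k, StronglyMeasurable (f' (d k)) := by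
    intro k
    have : f' (d k) = Aᶜ.indicator ((hm (d k)).mk (f (d k))) := by
      ext τ
      by_cases hτ : τ ∈ A
      · simp [f', hτ]
      · simp [f', hτ, hAe τ hτ k]
    rw [this]
    exact (hm (d k)).stronglyMeasurable_mk.indicator hAm.compl
  have hf'm : ∀ x, StronglyMeasurable (f' x) := by
    intro x
    obtain ⟨y, hy, hyx⟩ := mem_closure_iff_seq_limit.1 (hd x)
    refine stronglyMeasurable_of_tendsto atTop (f := fun m => f' (y m)) (fun m => ?_) ?_
    · obtain ⟨k, hk⟩ := hy m
      rw [← hk]; exact hf'd k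
    · rw [tendsto_pi_nhds]
      intro τ
      exact ((hf'c τ).tendsto x).comp hyx
  have hjoint := stronglyMeasurable_uncurry_of_continuous_of_stronglyMeasurable hf'c hf'm
  refine hjoint.aestronglyMeasurable.congr ?_
  have h0 : ∀ᵐ τ ∂ν, τ ∉ A := measure_eq_zero_iff_ae_notMem.1 hA0
  have h1 := (Measure.quasiMeasurePreserving_snd (μ := κ) (ν := ν)).ae h0
  filter_upwards [h1] with q hq
  simp [Function.uncurry, f', hq]

lemma aux_dichotomy {n : ℕ} {T : Type*} [MeasurableSpace T] (μ : Measure T)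
    (w : T → EE n → ℂ) (hc : ∀ τ, Continuous (w τ))
    (hent : ∀ (x : EE n) (i : Fin n), ∃ Φ : ℂ → T → ℂ, (∀ τ, Differentiable ℂ fun z => Φ z τ) ∧
      ∀ (r : ℝ) τ, Φ r τ = w τ (x + EuclideanSpace.single i r))
    (hpos : volume {x : EE n | AEStronglyMeasurable (fun τ => w τ x) μ} ≠ 0) (x : EE n) :
    AEStronglyMeasurable (fun τ => w τ x) μ := by
  set M := {x : EE n | AEStronglyMeasurable (fun τ => w τ x) μ} with hMdef
  have hMc : IsClosed M := by
    refine IsSeqClosed.isClosed ?_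
    intro y x hy hyx
    refine aestronglyMeasurable_of_tendsto_ae atTop hy (ae_of_all _ fun τ => ?_)
    exact ((hc τ).tendsto x).comp hyx
  have hmp := PiLp.volume_preserving_toLp (Fin n)
  have hM' : MeasurableSet (WithLp.toLp 2 ⁻¹' M : Set (Fin n → ℝ)) :=
    hmp.measurable hMc.measurableSet
  have key := aux_slices n (WithLp.toLp 2 ⁻¹' M) hM' ?_ ?_ (WithLp.ofLp x)
  · exact key
  · intro v i hv s
    obtain ⟨Φ, hΦ1, hΦ2⟩ := hent (WithLp.toLp 2 v) i
    have hup : ∀ s : ℝ, (WithLp.toLp 2 (Function.update v i s) : EE n)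
        = WithLp.toLp 2 v + EuclideanSpace.single i (s - v i) := by
      intro s
      ext j
      by_cases hj : j = i
      · subst hj; simp
      · simp [hj]
    have hΦ3 : ∀ s : ℝ, (fun τ => w τ (WithLp.toLp 2 (Function.update v i s)))
        = fun τ => Φ ((s : ℂ) - v i) τ := by
      intro s; ext τ
      rw [hup, ← hΦ2]; push_cast; rfl
    have := aux_meas_line μ (fun z τ => Φ (z - v i) τ)
      (fun τ => (hΦ1 τ).comp (differentiable_id.sub_const _)) ?_ s
    · simp only [mem_preimage, hMdef, mem_ofPred_eq, hΦ3]
      exact this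
    · simp only [mem_preimage, hMdef, mem_ofPred_eq, hΦ3] at hv
      exact hv
  · rwa [hmp.measure_preimage hMc.measurableSet.nullMeasurableSet]

lemma aux_fubini {n : ℕ} (μ : Measure ℝ) [SFinite μ] (w : ℝ → EE n → ℂ) (hc : ∀ τ, Continuous (w τ))
    (hi : ∀ τ, Integrable (w τ)) (hm : ∀ x, AEStronglyMeasurable (fun τ => w τ x) μ)
    (B : ℝ → ℝ) (hB : Integrable B μ) (hwB : ∀ᵐ τ ∂μ, ∫ x, ‖w τ x‖ ≤ B τ) :
    Integrable (fun x => ∫ τ, w τ x ∂μ) ∧ ∀ ξ,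
      𝓕 (fun x => ∫ τ, w τ x ∂μ) ξ = ∫ τ, 𝓕 (w τ) ξ ∂μ := by
  have hjm := aux_carath (volume : Measure (EE n)) μ (fun x τ => w τ x) hc hm
  have hint : Integrable (fun q : EE n × ℝ => w q.2 q.1) (volume.prod μ) := by
    rw [integrable_prod_iff' hjm]
    refine ⟨ae_of_all _ fun τ => hi τ, ?_⟩
    refine hB.mono' ?_ ?_
    · exact hjm.norm.prod_swap.integral_prod_right'
    · filter_upwards [hwB] with τ hτ
      rwa [Real.norm_of_nonneg (integral_nonneg fun _ => norm_nonneg _)]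
  refine ⟨hint.integral_prod_left, fun ξ => ?_⟩
  simp only [Real.fourier_eq]
  rw [← integral_integral_swap]
  · congr 1; ext x
    simp only [Circle.smul_def]
    rw [integral_smul]
  · have : Integrable (fun q : EE n × ℝ => (Real.fourierChar (-inner ℝ q.1 ξ) : ℂ) * w q.2 q.1)
        (volume.prod μ) := by
      refine hint.bdd_mul (c := 1) ?_ (ae_of_all _ fun q => ?_)
      · refine Continuous.aestronglyMeasurable ?_
        exact continuous_subtype_val.comp (Real.continuous_fourierChar.comp (by fun_prop))
      · exact (Circle.norm_coe _).le
    exact this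

section aux5
open Set

lemma aux_heat_zero {n : ℕ} (s : ℝ) : heat s (0 : EE n → ℂ) = 0 := by
  ext x; simp [heat]

lemma aux_exp_diff {c t τ : ℝ} (hc : 0 ≤ c) (h0 : 0 ≤ τ) (h1 : τ ≤ t / 2) :
    |Real.exp (-(c * (t - τ))) - Real.exp (-(c * t))| ≤ c * τ * Real.exp (-(c * t / 2)) := by
  have e : Real.exp (-(c * (t - τ))) - Real.exp (-(c * t))
      = Real.exp (-(c * (t - τ))) * (1 - Real.exp (-(c * τ))) := by
    rw [mul_one_sub, ← Real.exp_add]; congr 2; ring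
  have hcτ : 0 ≤ c * τ := by positivity
  have h2 : 0 ≤ 1 - Real.exp (-(c * τ)) := by
    have : Real.exp (-(c * τ)) ≤ 1 := Real.exp_le_one_iff.2 (by linarith)
    linarith
  have h3 : 1 - Real.exp (-(c * τ)) ≤ c * τ := by
    have := Real.add_one_le_exp (-(c * τ)); linarith
  rw [e, abs_of_nonneg (by positivity), mul_comm]
  gcongr
  nlinarith

lemma aux_main {n : ℕ} {t : ℝ} (ht : 0 < t) (F : ℝ → EE n → ℂ) (hF : ∀ τ, Integrable (F τ))
    (hF0 : ∀ τ, τ ∉ Ioc 0 (t / 2) → F τ = 0) (B : ℝ → ℝ) (hBi : IntegrableOn B (Ioc 0 (t / 2)))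
    (hBi' : IntegrableOn (fun τ => τ * B τ) (Ioc 0 (t / 2)))
    (hFB : ∀ τ ∈ Ioc 0 (t / 2), ∫ x, ‖F τ x‖ ≤ B τ) :
    Integrable (fun x => ∫ τ in Ioc 0 (t / 2), (heat (t - τ) (F τ) x - heat t (F τ) x)) ∧
    ∀ ξ, ‖𝓕 (fun x => ∫ τ in Ioc 0 (t / 2), (heat (t - τ) (F τ) x - heat t (F τ) x)) ξ‖ ≤
      (4 * π ^ 2 * ‖ξ‖ ^ 2) * Real.exp (-(4 * π ^ 2 * ‖ξ‖ ^ 2 * t / 2)) *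
        ∫ τ in Ioc 0 (t / 2), τ * B τ := by
  set μ : Measure ℝ := volume.restrict (Ioc 0 (t / 2)) with hμ
  let w : ℝ → EE n → ℂ := fun τ x => heat (t - τ) (F τ) x - heat t (F τ) x
  have hpos : ∀ τ ∈ Ioc 0 (t / 2), 0 < t - τ := fun τ hτ => by linarith [hτ.2]
  have hw0 : ∀ τ, τ ∉ Ioc 0 (t / 2) → w τ = 0 := by
    intro τ hτ; ext x; simp [w, hF0 τ hτ, aux_heat_zero]
  have hc : ∀ τ, Continuous (w τ) := by
    intro τ
    by_cases hτ : τ ∈ Ioc 0 (t / 2)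
    · exact (aux_heat_continuous (hpos τ hτ) _ (hF τ)).sub (aux_heat_continuous ht _ (hF τ))
    · rw [hw0 τ hτ]; exact continuous_zero
  have hi : ∀ τ, Integrable (w τ) := by
    intro τ
    by_cases hτ : τ ∈ Ioc 0 (t / 2)
    · exact (aux_heat_integrable (hpos τ hτ) _ (hF τ)).sub (aux_heat_integrable ht _ (hF τ))
    · rw [hw0 τ hτ]; exact integrable_zero _ _ _
  have hB0 : 0 ≤ ∫ τ in Ioc 0 (t / 2), τ * B τ :=
    setIntegral_nonneg measurableSet_Ioc fun τ hτ =>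
      mul_nonneg hτ.1.le ((integral_nonneg fun _ => norm_nonneg _).trans (hFB τ hτ))
  by_cases hM : volume {x : EE n | AEStronglyMeasurable (fun τ => w τ x) μ} = 0
  · have hu : (fun x => ∫ τ, w τ x ∂μ) =ᵐ[volume] 0 := by
      have := measure_eq_zero_iff_ae_notMem.1 hM
      filter_upwards [this] with x hx
      exact integral_non_aestronglyMeasurable hx
    refine ⟨(integrable_zero _ _ _).congr hu.symm, fun ξ => ?_⟩
    have : 𝓕 (fun x => ∫ τ, w τ x ∂μ) ξ = 0 := by
      rw [Real.fourier_eq]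
      rw [integral_eq_zero_of_ae]
      filter_upwards [hu] with x hx
      rw [hx]; simp
    refine (le_of_eq (by exact norm_eq_zero.2 this)).trans ?_
    positivity
  · have hm := aux_dichotomy μ w hc (fun x i => ?_) hM
    swap
    · refine ⟨fun z τ => auxH (t - τ) (F τ) x i z - auxH t (F τ) x i z, fun τ => ?_, fun r τ => ?_⟩
      · by_cases hτ : τ ∈ Ioc 0 (t / 2)
        · exact (aux_H_diff (hpos τ hτ) _ (hF τ) x i).sub (aux_H_diff ht _ (hF τ) x i)
        · simp [hF0 τ hτ, auxH]
      · simp only [aux_H_real, w]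
    have hfub := aux_fubini μ w hc hi hm (fun τ => 2 * B τ) (hBi.const_mul 2) ?_
    swap
    · refine (ae_restrict_iff' measurableSet_Ioc).2 (ae_of_all _ fun τ hτ => ?_)
      have i1 := aux_heat_integrable (hpos τ hτ) _ (hF τ)
      have i2 := aux_heat_integrable ht _ (hF τ)
      calc ∫ x, ‖w τ x‖ ≤ ∫ x, (‖heat (t - τ) (F τ) x‖ + ‖heat t (F τ) x‖) :=
            integral_mono (hi τ).norm (i1.norm.add i2.norm) fun x => norm_sub_le _ _
        _ = (∫ x, ‖heat (t - τ) (F τ) x‖) + ∫ x, ‖heat t (F τ) x‖ := integral_add i1.norm i2.norm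
        _ ≤ 2 * B τ := by
            have := aux_heat_norm (hpos τ hτ) _ (hF τ)
            have := aux_heat_norm ht _ (hF τ)
            have := hFB τ hτ
            linarith
    refine ⟨hfub.1, fun ξ => ?_⟩
    refine (le_of_eq (congrArg norm (hfub.2 ξ))).trans ?_
    rw [← integral_const_mul]
    refine norm_integral_le_of_norm_le (hBi'.const_mul _) ?_
    refine (ae_restrict_iff' measurableSet_Ioc).2 (ae_of_all _ fun τ hτ => ?_)
    have i1 := aux_heat_integrable (hpos τ hτ) _ (hF τ)
    have i2 := aux_heat_integrable ht _ (hF τ)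
    have e1 : 𝓕 (w τ) ξ = 𝓕 (heat (t - τ) (F τ)) ξ - 𝓕 (heat t (F τ)) ξ := by
      simp only [Real.fourier_eq, w]
      rw [← integral_sub]
      · congr 1; ext x; rw [smul_sub]
      · exact (Real.fourierIntegral_convergent_iff ξ).2 i1
      · exact (Real.fourierIntegral_convergent_iff ξ).2 i2
    rw [e1, aux_heat_fourier (hpos τ hτ) _ (hF τ), aux_heat_fourier ht _ (hF τ), ← sub_mul, norm_mul,
      ← Complex.ofReal_sub, Complex.norm_real, Real.norm_eq_abs]
    have e2 : ‖𝓕 (F τ) ξ‖ ≤ B τ := by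
      refine le_trans ?_ (hFB τ hτ)
      exact VectorFourier.norm_fourierIntegral_le_integral_norm _ _ _ _ _
    have e3 := aux_exp_diff (c := 4 * π ^ 2 * ‖ξ‖ ^ 2) (t := t) (by positivity) hτ.1.le hτ.2
    rw [show 4 * π ^ 2 * (t - τ) * ‖ξ‖ ^ 2 = 4 * π ^ 2 * ‖ξ‖ ^ 2 * (t - τ) by ring,
      show 4 * π ^ 2 * t * ‖ξ‖ ^ 2 = 4 * π ^ 2 * ‖ξ‖ ^ 2 * t by ring]
    have hτ0 := hτ.1.le
    refine (mul_le_mul e3 e2 (norm_nonneg _) (by positivity)).trans (le_of_eq ?_)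
    ring

lemma aux_rpow_gauss (m : ℝ) (hm : 0 ≤ m) : ∃ K : ℝ, 0 < K ∧ ∀ r : ℝ, 0 ≤ r →
    r ^ m * Real.exp (-(π ^ 2 * r ^ 2)) ≤ K := by
  obtain ⟨N, hN⟩ := exists_nat_ge m
  refine ⟨1 + N.factorial, by positivity, fun r hr => ?_⟩
  have h1 : r ^ m ≤ 1 + (r ^ 2) ^ N := by
    rcases le_total r 1 with h | h
    · have := Real.rpow_le_one hr h hm
      have : 0 ≤ (r ^ 2) ^ N := by positivity
      linarith
    · have a1 : r ^ m ≤ r ^ ((2 * N : ℕ) : ℝ) := by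
        apply Real.rpow_le_rpow_of_exponent_le h
        push_cast; linarith [(Nat.cast_nonneg N : (0:ℝ) ≤ N)]
      rw [Real.rpow_natCast, pow_mul] at a1
      linarith
  have hπ : 1 ≤ π ^ 2 := by nlinarith [Real.pi_gt_three]
  have h2 : (r ^ 2) ^ N ≤ (π ^ 2 * r ^ 2) ^ N := by
    gcongr
    nlinarith [sq_nonneg r]
  have h3 := Real.pow_div_factorial_le_exp (π ^ 2 * r ^ 2) (by positivity) N
  rw [div_le_iff₀ (by positivity)] at h3
  have h4 : 1 ≤ Real.exp (π ^ 2 * r ^ 2) := Real.one_le_exp (by positivity)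
  rw [Real.exp_neg, ← div_eq_mul_inv, div_le_iff₀ (Real.exp_pos _)]
  nlinarith

lemma aux_gauss_L2 (n : ℕ) {t : ℝ} (ht : 0 < t) :
    Integrable (fun ξ : EE n => Real.exp (-(π ^ 2 * t * ‖ξ‖ ^ 2))) ∧
    MemLp (fun ξ : EE n => Real.exp (-(π ^ 2 * t * ‖ξ‖ ^ 2))) 2 ∧
    eLpNorm (fun ξ : EE n => Real.exp (-(π ^ 2 * t * ‖ξ‖ ^ 2))) 2
      ≤ ENNReal.ofReal (t ^ (-(n : ℝ) / 4)) := by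
  have hi : ∀ b : ℝ, 0 < b → Integrable (fun ξ : EE n => Real.exp (-(b * ‖ξ‖ ^ 2))) := by
    intro b hb
    have h := (GaussianFourier.integrable_cexp_neg_mul_sq_norm_add (V := EE n)
      (b := (b : ℂ)) (by simpa using hb) 0 0).norm
    refine h.congr (ae_of_all _ fun x => ?_)
    simp only [zero_mul, add_zero]
    rw [Complex.norm_exp]
    congr 1
    rw [show -(b:ℂ) * (‖x‖:ℂ) ^ 2 = ((-(b * ‖x‖ ^ 2) : ℝ) : ℂ) by push_cast; ring, Complex.ofReal_re]
  have hsq : ∀ ξ : EE n, Real.exp (-(π ^ 2 * t * ‖ξ‖ ^ 2)) ^ 2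
      = Real.exp (-((2 * π ^ 2 * t) * ‖ξ‖ ^ 2)) := by
    intro ξ; rw [← Real.exp_nat_mul]; congr 1; push_cast; ring
  have hmem : MemLp (fun ξ : EE n => Real.exp (-(π ^ 2 * t * ‖ξ‖ ^ 2))) 2 := by
    rw [memLp_two_iff_integrable_sq (hi _ (by positivity)).1]
    simp only [hsq]
    exact hi _ (by positivity)
  refine ⟨hi _ (by positivity), hmem, ?_⟩
  rw [hmem.eLpNorm_eq_integral_rpow_norm (by norm_num) (by norm_num)]
  apply ENNReal.ofReal_le_ofReal
  have e : ∫ ξ : EE n, ‖Real.exp (-(π ^ 2 * t * ‖ξ‖ ^ 2))‖ ^ (2 : ℝ≥0∞).toReal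
      = (π / (2 * π ^ 2 * t)) ^ ((n : ℝ) / 2) := by
    have := GaussianFourier.integral_rexp_neg_mul_sq_norm (V := EE n) (b := 2 * π ^ 2 * t)
      (by positivity)
    rw [finrank_euclideanSpace, Fintype.card_fin] at this
    rw [← this]
    congr 1; ext ξ
    rw [ENNReal.toReal_ofNat, Real.rpow_ofNat, Real.norm_of_nonneg (Real.exp_pos _).le, hsq]
    congr 1; ring
  rw [e, ← Real.rpow_mul (by positivity), ENNReal.toReal_ofNat]
  have e2 : t ^ (-(n:ℝ) / 4) = (1 / t) ^ ((n : ℝ) / 2 * 2⁻¹) := by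
    rw [one_div, Real.inv_rpow ht.le, ← Real.rpow_neg ht.le]; congr 1; ring
  rw [e2]
  apply Real.rpow_le_rpow (by positivity) _ (by positivity)
  rw [div_le_div_iff₀ (by positivity) ht]
  have : 1 ≤ 2 * π := by linarith [Real.pi_gt_three]
  have h2 : 0 < π * t := by positivity
  nlinarith

lemma aux_final {n : ℕ} {t : ℝ} (ht : 0 < t) (k : ℝ) (hk : 0 ≤ k) (K : ℝ) (hK : 0 < K)
    (hKb : ∀ r : ℝ, 0 ≤ r → r ^ (k + 2) * Real.exp (-(π ^ 2 * r ^ 2)) ≤ K)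
    (u : EE n → ℂ) (hu : Integrable u) (A : ℝ) (hA : 0 ≤ A)
    (hb : ∀ ξ, ‖𝓕 u ξ‖ ≤ (4 * π ^ 2 * ‖ξ‖ ^ 2) * Real.exp (-(4 * π ^ 2 * ‖ξ‖ ^ 2 * t / 2)) * A) :
    eLpNorm (fracDeriv k u) 2 volume ≤
      ENNReal.ofReal (4 * π ^ 2 * A * K * t ^ (-(k + 2) / 2 - (n : ℝ) / 4)) := by
  obtain ⟨g1, g2, g3⟩ := aux_gauss_L2 n ht
  let c : ℝ := 4 * π ^ 2 * A * K * t ^ (-(k + 2) / 2)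
  have hc : 0 ≤ c := by positivity
  let f : EE n → ℂ := fun ξ => ((‖ξ‖ ^ k : ℝ) : ℂ) * 𝓕 u ξ
  have hfc : Continuous f := by
    have : Continuous (𝓕 u) := VectorFourier.fourierIntegral_continuous Real.continuous_fourierChar
      (by exact continuous_inner) hu
    exact (Complex.continuous_ofReal.comp (continuous_norm.rpow_const fun _ => Or.inr hk)).mul this
  have hfb : ∀ ξ, ‖f ξ‖ ≤ c * Real.exp (-(π ^ 2 * t * ‖ξ‖ ^ 2)) := by
    intro ξ
    simp only [f]
    rw [norm_mul, Complex.norm_real, Real.norm_of_nonneg (by positivity)]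
    set r := ‖ξ‖
    have hr : 0 ≤ r := norm_nonneg _
    have h1 := hKb (t ^ (1/2 : ℝ) * r) (by positivity)
    have e1 : (t ^ (1/2 : ℝ) * r) ^ (k + 2) = t ^ ((k + 2) / 2) * (r ^ k * r ^ 2) := by
      rw [Real.mul_rpow (by positivity) hr, ← Real.rpow_mul ht.le,
        Real.rpow_add_of_nonneg hr hk (by norm_num), Real.rpow_ofNat]
      congr 2; ring
    have e2 : (t ^ (1/2 : ℝ) * r) ^ 2 = t * r ^ 2 := by
      rw [mul_pow, ← Real.rpow_natCast, ← Real.rpow_mul ht.le]; norm_num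
    rw [e1, e2] at h1
    have e3 : t ^ (-(k + 2) / 2) * t ^ ((k + 2) / 2) = 1 := by
      rw [← Real.rpow_add ht, show -(k + 2) / 2 + (k + 2) / 2 = 0 by ring, Real.rpow_zero]
    have e4 : Real.exp (-(4 * π ^ 2 * r ^ 2 * t / 2))
        = Real.exp (-(π ^ 2 * (t * r ^ 2))) * Real.exp (-(π ^ 2 * t * r ^ 2)) := by
      rw [← Real.exp_add]; congr 1; ring
    calc r ^ k * ‖𝓕 u ξ‖ ≤ r ^ k * ((4 * π ^ 2 * r ^ 2) *
          Real.exp (-(4 * π ^ 2 * r ^ 2 * t / 2)) * A) := by gcongr; exact hb ξ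
      _ = 4 * π ^ 2 * A * (t ^ (-(k + 2) / 2) * t ^ ((k + 2) / 2)) * (r ^ k * r ^ 2) *
          (Real.exp (-(π ^ 2 * (t * r ^ 2))) * Real.exp (-(π ^ 2 * t * r ^ 2))) := by
          rw [e3, e4]; ring
      _ = 4 * π ^ 2 * A * t ^ (-(k + 2) / 2) * (t ^ ((k + 2) / 2) * (r ^ k * r ^ 2) *
          Real.exp (-(π ^ 2 * (t * r ^ 2)))) * Real.exp (-(π ^ 2 * t * r ^ 2)) := by ring
      _ ≤ 4 * π ^ 2 * A * t ^ (-(k + 2) / 2) * K * Real.exp (-(π ^ 2 * t * r ^ 2)) := by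
          gcongr
      _ = _ := by simp only [c]; ring
  have hf1 : Integrable f :=
    (g1.const_mul c).mono' hfc.aestronglyMeasurable (ae_of_all _ hfb)
  have hf2 : MemLp f 2 volume :=
    (g2.const_mul c).of_le hfc.aestronglyMeasurable (ae_of_all _ fun ξ =>
      (hfb ξ).trans (le_abs_self _))
  have : fracDeriv k u = 𝓕⁻ f := rfl
  rw [this, aux_plancherel_inv f hf1 hf2]
  calc eLpNorm f 2 volume
      ≤ ENNReal.ofReal c * eLpNorm (fun ξ : EE n => Real.exp (-(π ^ 2 * t * ‖ξ‖ ^ 2))) 2 volume := by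
        refine eLpNorm_le_mul_eLpNorm_of_ae_le_mul (ae_of_all _ fun ξ => ?_) _
        rw [Real.norm_of_nonneg (Real.exp_pos _).le]; exact hfb ξ
    _ ≤ ENNReal.ofReal c * ENNReal.ofReal (t ^ (-(n : ℝ) / 4)) := by gcongr
    _ = _ := by
        rw [← ENNReal.ofReal_mul hc]
        congr 1
        simp only [c]
        rw [mul_assoc _ (t ^ _) (t ^ _), ← Real.rpow_add ht]
        congr 2; ring

lemma aux_time {a t : ℝ} (ha : a < 2) (ht : 2 ≤ t) :
    ∫ τ in Ioc 0 (t / 2), τ * (1 + τ) ^ (-a) ≤ t ^ (2 - a) / (2 - a) := by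
  have h0 : (0:ℝ) ≤ t / 2 := by linarith
  rw [← intervalIntegral.integral_of_le h0]
  have hcont : ∀ b : ℝ, ContinuousOn (fun τ : ℝ => (1 + τ) ^ b) (uIcc 0 (t / 2)) := by
    intro b
    refine ContinuousOn.rpow_const (by fun_prop) fun x hx => Or.inl ?_
    rw [uIcc_of_le h0] at hx
    linarith [hx.1]
  have hd : ∀ τ ∈ uIcc 0 (t / 2), HasDerivAt (fun τ : ℝ => (1 + τ) ^ (2 - a) / (2 - a))
      ((1 + τ) ^ (1 - a)) τ := by
    intro τ hτ
    rw [uIcc_of_le h0] at hτ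
    have h1 : HasDerivAt (fun τ : ℝ => 1 + τ) 1 τ := (hasDerivAt_id τ).const_add 1
    have h2 := (h1.rpow_const (p := 2 - a) (Or.inl (by linarith [hτ.1]))).div_const (2 - a)
    have h3 : 2 - a ≠ 0 := by linarith
    have h4 : 1 * (2 - a) * (1 + τ) ^ (2 - a - 1) / (2 - a) = (1 + τ) ^ (1 - a) := by
      rw [show 2 - a - 1 = 1 - a by ring]
      field_simp
    rw [h4] at h2
    exact h2
  calc ∫ τ in (0:ℝ)..(t / 2), τ * (1 + τ) ^ (-a) ≤ ∫ τ in (0:ℝ)..(t / 2), (1 + τ) ^ (1 - a) := by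
        refine intervalIntegral.integral_mono_on h0 ?_ (hcont _).intervalIntegrable ?_
        · exact (continuousOn_id.mul (hcont _)).intervalIntegrable
        · intro τ hτ
          have hp : 0 < 1 + τ := by linarith [hτ.1]
          rw [show 1 - a = 1 + -a by ring, Real.rpow_add hp, Real.rpow_one]
          gcongr
          linarith
    _ = (1 + t / 2) ^ (2 - a) / (2 - a) - (1 + 0) ^ (2 - a) / (2 - a) :=
        intervalIntegral.integral_eq_sub_of_hasDerivAt hd (hcont _).intervalIntegrable
    _ ≤ (1 + t / 2) ^ (2 - a) / (2 - a) := by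
        have : (0:ℝ) ≤ (1 + 0) ^ (2 - a) / (2 - a) := by
          apply div_nonneg (by positivity); linarith
        linarith
    _ ≤ _ := by
        have h2 : 0 < 2 - a := by linarith
        gcongr
        linarith

lemma aux_bound (n : ℕ) (a : ℝ) (ha : a < 2) (k : ℝ) (hk : 0 ≤ k)
    (F : ℝ → EE n → ℂ) (C : ℝ) (hC : 0 < C)
    (hF : ∀ τ : ℝ, 0 ≤ τ → eLpNorm (F τ) 1 volume ≤ ENNReal.ofReal (C * (1 + τ) ^ (-a))) :
    ∃ C' > (0:ℝ), ∀ t : ℝ, 2 ≤ t →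
      eLpNorm (fracDeriv k (fun x =>
          ∫ τ in (0:ℝ)..(t / 2), (heat (t - τ) (F τ) x - heat t (F τ) x))) 2 volume
        ≤ ENNReal.ofReal (C' * t ^ (-(n : ℝ) / 4 - k / 2 - a + 1)) := by
  classical
  obtain ⟨K, hK, hKb⟩ := aux_rpow_gauss (k + 2) (by linarith)
  have h2a : 0 < 2 - a := by linarith
  refine ⟨4 * π ^ 2 * (C / (2 - a)) * K, by positivity, fun t ht => ?_⟩
  have ht0 : 0 < t := by linarith
  have h0 : (0:ℝ) ≤ t / 2 := by linarith
  let F' : ℝ → EE n → ℂ := fun τ =>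
    if τ ∈ Ioc 0 (t / 2) ∧ AEStronglyMeasurable (F τ) volume then F τ else 0
  let B : ℝ → ℝ := fun τ => C * (1 + τ) ^ (-a)
  have hBc : ContinuousOn B (Icc 0 (t / 2)) := by
    refine continuousOn_const.mul (ContinuousOn.rpow_const (by fun_prop) fun x hx => Or.inl ?_)
    linarith [hx.1]
  have hB0 : ∀ τ, 0 ≤ τ → 0 ≤ B τ := fun τ hτ => by positivity
  have hFI : ∀ τ, 0 ≤ τ → AEStronglyMeasurable (F τ) volume → Integrable (F τ) := by
    intro τ hτ hm
    rw [← memLp_one_iff_integrable]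
    exact ⟨hm, (hF τ hτ).trans_lt ENNReal.ofReal_lt_top⟩
  have hF'I : ∀ τ, Integrable (F' τ) := by
    intro τ
    simp only [F']
    split_ifs with h
    · exact hFI τ h.1.1.le h.2
    · exact integrable_zero _ _ _
  have hF'B : ∀ τ ∈ Ioc 0 (t / 2), ∫ x, ‖F' τ x‖ ≤ B τ := by
    intro τ hτ
    by_cases hm : AEStronglyMeasurable (F τ) volume
    · have : F' τ = F τ := if_pos ⟨hτ, hm⟩
      rw [this, integral_norm_eq_lintegral_enorm hm, ← eLpNorm_one_eq_lintegral_enorm]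
      exact ENNReal.toReal_le_of_le_ofReal (hB0 τ hτ.1.le) (hF τ hτ.1.le)
    · have : F' τ = 0 := if_neg fun h => hm h.2
      rw [this]
      simpa using hB0 τ hτ.1.le
  have hmain := aux_main ht0 F' hF'I (fun τ hτ => if_neg fun h => hτ h.1) B
    (hBc.integrableOn_Icc.mono_set Ioc_subset_Icc_self)
    ((continuousOn_id.mul hBc).integrableOn_Icc.mono_set Ioc_subset_Icc_self) hF'B
  have hu : (fun x => ∫ τ in (0:ℝ)..(t / 2), (heat (t - τ) (F τ) x - heat t (F τ) x))
      = fun x => ∫ τ in Ioc 0 (t / 2), (heat (t - τ) (F' τ) x - heat t (F' τ) x) := by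
    ext x
    rw [intervalIntegral.integral_of_le h0]
    refine setIntegral_congr_fun measurableSet_Ioc fun τ hτ => ?_
    by_cases hm : AEStronglyMeasurable (F τ) volume
    · have : F' τ = F τ := if_pos ⟨hτ, hm⟩
      simp only [this]
    · have : F' τ = 0 := if_neg fun h => hm h.2
      simp only [this]
      rw [aux_heat_not_meas (by linarith [hτ.2]) _ hm, aux_heat_not_meas ht0 _ hm]
      simp [aux_heat_zero]
  rw [hu]
  have hA : ∫ τ in Ioc 0 (t / 2), τ * B τ ≤ C * (t ^ (2 - a) / (2 - a)) := by
    have : ∀ τ : ℝ, τ * B τ = C * (τ * (1 + τ) ^ (-a)) := fun τ => by simp only [B]; ring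
    simp only [this]
    rw [integral_const_mul]
    exact mul_le_mul_of_nonneg_left (aux_time ha ht) hC.le
  refine (aux_final ht0 k hk K hK hKb _ hmain.1 (C * (t ^ (2 - a) / (2 - a))) (by positivity)
    (fun ξ => (hmain.2 ξ).trans (mul_le_mul_of_nonneg_left hA (by positivity)))).trans (le_of_eq ?_)
  congr 1
  rw [show -(n : ℝ) / 4 - k / 2 - a + 1 = (2 - a) + (-(k + 2) / 2 - (n : ℝ) / 4) by ring,
    Real.rpow_add ht0]
  ring

end aux5
end aux4
end aux3
end aux2
end aux

/-- Estimate for `A₃(t) = ∫₀^{t/2} (e^{(t-τ)Δ} - e^{tΔ}) F(τ) dτ` when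
`1 + 2/n < p < 1 + 4/n`, together with the resulting `o(t^{-n/4-k/2})` decay. -/
theorem stmt18 (n : ℕ) (hn : 1 ≤ n) (p : ℝ) (hp1 : 1 + 2 / n < p)
    (hp2 : p < 1 + 4 / n) (k : ℝ) (hk : 0 ≤ k)
    (F : ℝ → EuclideanSpace ℝ (Fin n) → ℂ) (C : ℝ) (hC : 0 < C)
    (hF : ∀ τ : ℝ, 0 ≤ τ →
      eLpNorm (F τ) 1 (volume : Measure (EuclideanSpace ℝ (Fin n)))
        ≤ ENNReal.ofReal (C * (1 + τ) ^ (-(n : ℝ) / 2 * (p - 1)))) :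
    (∃ C' > (0:ℝ), ∀ t : ℝ, 2 ≤ t →
      eLpNorm (fracDeriv k (fun x =>
          ∫ τ in (0:ℝ)..(t / 2), (heat (t - τ) (F τ) x - heat t (F τ) x))) 2 volume
        ≤ ENNReal.ofReal
            (C' * t ^ (-(n : ℝ) / 4 - k / 2 - (n : ℝ) / 2 * (p - 1) + 1))) ∧
    Tendsto (fun t : ℝ =>
        t ^ ((n : ℝ) / 4 + k / 2) *
          (eLpNorm (fracDeriv k (fun x =>
            ∫ τ in (0:ℝ)..(t / 2), (heat (t - τ) (F τ) x - heat t (F τ) x))) 2 volume).toReal)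
      atTop (𝓝 0) := by
  have hn0 : (0:ℝ) < n := by exact_mod_cast hn
  have ha1 : 1 < (n : ℝ) / 2 * (p - 1) := by
    have : 2 / (n:ℝ) < p - 1 := by linarith
    rw [div_lt_iff₀ hn0] at this
    nlinarith
  have ha2 : (n : ℝ) / 2 * (p - 1) < 2 := by
    have : p - 1 < 4 / (n:ℝ) := by linarith
    rw [lt_div_iff₀ hn0] at this
    nlinarith
  obtain ⟨C', hC', hb⟩ := aux_bound n ((n : ℝ) / 2 * (p - 1)) ha2 k hk F C hC (by
    intro τ hτ
    have := hF τ hτ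
    rwa [show -(n : ℝ) / 2 * (p - 1) = -((n : ℝ) / 2 * (p - 1)) by ring] at this)
  refine ⟨⟨C', hC', hb⟩, ?_⟩
  have hlim : Tendsto (fun t : ℝ => C' * t ^ (-((n : ℝ) / 2 * (p - 1) - 1))) atTop (𝓝 0) := by
    simpa using (tendsto_rpow_neg_atTop (by linarith : 0 < (n : ℝ) / 2 * (p - 1) - 1)).const_mul C'
  refine squeeze_zero' ?_ ?_ hlim
  · filter_upwards [eventually_ge_atTop 2] with t ht
    have : (0:ℝ) ≤ t := by linarith
    positivity
  · filter_upwards [eventually_ge_atTop 2] with t ht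
    have ht0 : (0:ℝ) < t := by linarith
    have h1 := ENNReal.toReal_le_of_le_ofReal (by positivity) (hb t ht)
    refine (mul_le_mul_of_nonneg_left h1 (by positivity)).trans (le_of_eq ?_)
    rw [mul_left_comm, ← Real.rpow_add ht0]
    congr 2; ring
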